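/- Let c be a nonzero cubic form in n variables with real coefficients, let B ≥ 2 and C ≥ 1 be reals, and let σ ∈ {0,…,n−1}. Then there are constants A₁ depending only on C and n, and A₂ depending only on n, such that at least one of the following holds: (a) N^aux_c(B) ≤ A₁·B^{n+σ}·(log B)^n; (b) there exist positive-dimensional linear subspaces X, Y ⊆ ℝ^n with dim X + dim Y = n + σ + 1 such that |Yᵀ·H_c(X)·Y′| ≤ A₂·C^{−1}·‖Y‖_∞·‖X‖_∞·‖Y′‖_∞ for all X ∈ X and all Y, Y′ ∈ Y. -/

import Mathlib

open MvPolynomial Matrix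

/-- `‖c‖ = (1/6)·max_{i,j,k} |∂³c/∂x_i∂x_j∂x_k|` for a cubic form `c`. -/
noncomputable def cubicNorm {n : ℕ} (c : MvPolynomial (Fin n) ℝ) : ℝ :=
  (1 / 6) * ⨆ i : Fin n, ⨆ j : Fin n, ⨆ k : Fin n,
    |MvPolynomial.eval (0 : Fin n → ℝ) (pderiv i (pderiv j (pderiv k c)))|

/-- The normalised Hessian matrix `H_c(x)` with entries `(1/‖c‖)·∂²c(x)/∂x_i∂x_j`. -/
noncomputable def hessMat {n : ℕ} (c : MvPolynomial (Fin n) ℝ) (x : Fin n → ℝ) :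
    Matrix (Fin n) (Fin n) ℝ :=
  Matrix.of fun i j => (cubicNorm c)⁻¹ * MvPolynomial.eval x (pderiv i (pderiv j c))

/-- The counting function `N^aux_c(B)`: the number of pairs `(x, y) ∈ ℤ^n × ℤ^n`
with `‖x‖_∞ ≤ B`, `‖y‖_∞ ≤ B` and `‖H_c(x)·y‖_∞ < B`. -/
noncomputable def Naux {n : ℕ} (c : MvPolynomial (Fin n) ℝ) (B : ℝ) : ℕ :=
  Set.ncard {p : (Fin n → ℤ) × (Fin n → ℤ) |
    (∀ i, (|p.1 i| : ℝ) ≤ B) ∧ (∀ i, (|p.2 i| : ℝ) ≤ B) ∧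
    (∀ i, |(hessMat c (fun j => (p.1 j : ℝ))).mulVec (fun j => (p.2 j : ℝ)) i| < B)}

lemma pigR {α ι : Type*} [Fintype ι] [DecidableEq ι] (T : Finset α) (f : ι → α → ℝ) (M s : ι → ℝ)
    (hs : ∀ i, 0 < s i) (hM : ∀ x ∈ T, ∀ i, |f i x| ≤ M i) :
    ∃ T' ⊆ T, (∀ x ∈ T', ∀ x' ∈ T', ∀ i, |f i x - f i x'| ≤ s i) ∧
      (T.card : ℝ) ≤ (∏ i, (2 * M i / s i + 2)) * T'.card := by
  classical
  rcases T.eq_empty_or_nonempty with rfl | ⟨x0, hx0⟩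
  · exact ⟨∅, subset_rfl, by simp, by simp⟩
  have hM0 : ∀ i, 0 ≤ M i := fun i => (abs_nonneg _).trans (hM x0 hx0 i)
  set g : α → ι → ℤ := fun x i => ⌊f i x / s i⌋ with hg
  set t : Finset (ι → ℤ) := Fintype.piFinset fun i => Finset.Icc ⌊-(M i / s i)⌋ ⌊M i / s i⌋ with ht
  have hmaps : ∀ x ∈ T, g x ∈ t := by
    intro x hx
    rw [ht, Fintype.mem_piFinset]
    intro i
    rw [Finset.mem_Icc]
    have h := abs_le.1 (hM x hx i)
    constructor
    · apply Int.floor_le_floor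
      rw [← neg_div]
      exact div_le_div_of_nonneg_right h.1 (hs i).le
    · apply Int.floor_le_floor
      exact div_le_div_of_nonneg_right h.2 (hs i).le
  have htne : t.Nonempty := ⟨_, hmaps x0 hx0⟩
  have htc : (t.card : ℝ) ≤ ∏ i, (2 * M i / s i + 2) := by
    rw [ht, Fintype.card_piFinset]
    push_cast
    apply Finset.prod_le_prod
    · intros; positivity
    · intro i _
      rw [Int.card_Icc]
      have h1 : ⌊-(M i / s i)⌋ ≤ ⌊M i / s i⌋ := by
        apply Int.floor_le_floor
        have : 0 ≤ M i / s i := div_nonneg (hM0 i) (hs i).le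
        linarith
      have h2 : (((⌊M i / s i⌋ + 1 - ⌊-(M i / s i)⌋).toNat : ℤ) : ℝ) =
          (⌊M i / s i⌋ : ℝ) + 1 - ⌊-(M i / s i)⌋ := by
        rw [Int.toNat_of_nonneg (by omega)]
        push_cast; ring
      rw [← Int.cast_natCast, h2]
      have h3 := Int.floor_le (M i / s i)
      have h4 := Int.lt_floor_add_one (-(M i / s i))
      have : 2 * M i / s i = 2 * (M i / s i) := by ring
      linarith
  have htpos : (0 : ℝ) < t.card := by exact_mod_cast htne.card_pos
  obtain ⟨y, hy, hb⟩ := Finset.exists_le_card_fiber_of_nsmul_le_card_of_maps_to hmaps htne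
    (b := (T.card : ℝ) / t.card) (by rw [nsmul_eq_mul]; field_simp; exact le_rfl)
  refine ⟨T.filter fun x => g x = y, Finset.filter_subset _ _, ?_, ?_⟩
  · intro x hx x' hx' i
    have e1 := congrFun (Finset.mem_filter.1 hx).2 i
    have e2 := congrFun (Finset.mem_filter.1 hx').2 i
    have e : ⌊f i x / s i⌋ = ⌊f i x' / s i⌋ := by simp only [hg] at e1 e2; rw [e1, e2]
    have := Int.abs_sub_lt_one_of_floor_eq_floor e
    rw [← sub_div, abs_div, abs_of_pos (hs i), div_lt_one (hs i)] at this
    exact this.le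
  · rw [div_le_iff₀ htpos] at hb
    calc (T.card : ℝ) ≤ _ := hb
      _ = t.card * ((T.filter fun x => g x = y).card : ℝ) := mul_comm _ _
      _ ≤ _ := by gcongr

lemma eigR {n : ℕ} (A : Matrix (Fin n) (Fin n) ℝ) (hA : A.IsSymm) :
    ∃ (v : Fin n → Fin n → ℝ) (lam : Fin n → ℝ),
      (∀ i j, v i ⬝ᵥ v j = if i = j then 1 else 0) ∧ (∀ i, A *ᵥ v i = lam i • v i) ∧
      ∀ i j, i ≤ j → |lam j| ≤ |lam i| := by
  have hH : A.IsHermitian := by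
    rw [Matrix.IsHermitian, Matrix.conjTranspose_eq_transpose_of_trivial]; exact hA
  set π := Tuple.sort (fun i => -|hH.eigenvalues i|) with hπ
  refine ⟨fun i => (hH.eigenvectorBasis (π i)).ofLp, fun i => hH.eigenvalues (π i), ?_, ?_, ?_⟩
  · intro i j
    have h := orthonormal_iff_ite.1 hH.eigenvectorBasis.orthonormal (π i) (π j)
    rw [EuclideanSpace.inner_eq_star_dotProduct] at h
    simp only [star_trivial, π.injective.eq_iff] at h
    rw [dotProduct_comm]
    exact h
  · intro i
    exact hH.mulVec_eigenvectorBasis (π i)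
  · intro i j hij
    have := Tuple.monotone_sort (fun i => -|hH.eigenvalues i|) hij
    simp only [Function.comp] at this
    linarith


lemma on_expand {n : ℕ} {v : Fin n → Fin n → ℝ}
    (hv : ∀ i j, v i ⬝ᵥ v j = if i = j then 1 else 0) (y : Fin n → ℝ) : y = ∑ i, (v i ⬝ᵥ y) • v i := by
  have h1 : (Matrix.of v) * (Matrix.of v)ᵀ = 1 := by
    ext i j
    rw [Matrix.mul_apply, Matrix.one_apply, ← hv i j]
    rfl
  have h2 : (Matrix.of v)ᵀ * (Matrix.of v) = 1 := mul_eq_one_comm.1 h1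
  have h3 : (Matrix.of v)ᵀ *ᵥ ((Matrix.of v) *ᵥ y) = y := by
    rw [Matrix.mulVec_mulVec, h2, Matrix.one_mulVec]
  conv_lhs => rw [← h3]
  ext k
  simp only [Matrix.mulVec, dotProduct, Matrix.transpose_apply, Matrix.of_apply, Finset.sum_apply, Pi.smul_apply, smul_eq_mul]
  exact Finset.sum_congr rfl fun i _ => mul_comm _ _

lemma on_le_one {n : ℕ} {v : Fin n → Fin n → ℝ}
    (hv : ∀ i j, v i ⬝ᵥ v j = if i = j then 1 else 0) (i k : Fin n) : |v i k| ≤ 1 := by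
  have h := hv i i
  rw [if_pos rfl] at h
  have : v i k * v i k ≤ v i ⬝ᵥ v i :=
    Finset.single_le_sum (f := fun k => v i k * v i k) (fun k _ => mul_self_nonneg _) (Finset.mem_univ k)
  rw [h] at this
  exact abs_le_one_iff_mul_self_le_one.2 this

lemma on_norm_le {n : ℕ} {v : Fin n → Fin n → ℝ}
    (hv : ∀ i j, v i ⬝ᵥ v j = if i = j then 1 else 0) (y : Fin n → ℝ) : ‖y‖ ≤ ∑ i, |v i ⬝ᵥ y| := by
  rw [pi_norm_le_iff_of_nonneg (Finset.sum_nonneg fun _ _ => abs_nonneg _)]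
  intro k
  conv_lhs => rw [on_expand hv y]
  rw [Finset.sum_apply, Real.norm_eq_abs]
  refine (Finset.abs_sum_le_sum_abs _ _).trans (Finset.sum_le_sum fun i _ => ?_)
  rw [Pi.smul_apply, smul_eq_mul, abs_mul]
  exact mul_le_of_le_one_right (abs_nonneg _) (on_le_one hv i k)

lemma on_linindep {n : ℕ} {v : Fin n → Fin n → ℝ}
    (hv : ∀ i j, v i ⬝ᵥ v j = if i = j then 1 else 0) : LinearIndependent ℝ v := by
  rw [Fintype.linearIndependent_iff]
  intro g hg i
  have := congrArg (fun z => v i ⬝ᵥ z) hg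
  simpa [dotProduct_sum, hv] using this

lemma on_span_dim {n : ℕ} {v : Fin n → Fin n → ℝ}
    (hv : ∀ i j, v i ⬝ᵥ v j = if i = j then 1 else 0) (p : Fin n → Prop) [DecidablePred p] :
    Module.finrank ℝ (Submodule.span ℝ (Set.range fun i : {i // p i} => v i)) =
      Fintype.card {i // p i} :=
  finrank_span_eq_card ((on_linindep hv).comp _ Subtype.val_injective)

lemma on_span_zero {n : ℕ} {v : Fin n → Fin n → ℝ}
    (hv : ∀ i j, v i ⬝ᵥ v j = if i = j then 1 else 0) (p : Fin n → Prop) {x : Fin n → ℝ}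
    (hx : x ∈ Submodule.span ℝ (Set.range fun i : {i // p i} => v i)) (i : Fin n) (hi : ¬ p i) :
    v i ⬝ᵥ x = 0 := by
  induction hx using Submodule.span_induction with
  | mem x h =>
    obtain ⟨j, rfl⟩ := h
    rw [hv, if_neg]
    rintro rfl
    exact hi j.2
  | zero => simp
  | add x y _ _ hx hy => rw [dotProduct_add, hx, hy, add_zero]
  | smul a x _ hx => rw [dotProduct_smul, hx, smul_zero]


lemma dot_le {n : ℕ} {y z : Fin n → ℝ} {a b : ℝ} (ha : 0 ≤ a) (hy : ∀ i, |y i| ≤ a) (hz : ∀ i, |z i| ≤ b) :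
    |y ⬝ᵥ z| ≤ n * (a * b) := by
  refine (Finset.abs_sum_le_sum_abs _ _).trans ?_
  calc ∑ i, |y i * z i| ≤ ∑ i : Fin n, a * b := by
        refine Finset.sum_le_sum fun i _ => ?_
        rw [abs_mul]
        exact mul_le_mul (hy i) (hz i) (abs_nonneg _) ha
    _ = _ := by simp

/-- covering a set that is a Lipschitz graph at scale `r` over an `m`-plane. -/
lemma geoR {n : ℕ} {u : Fin n → Fin n → ℝ} (hu : ∀ i j, u i ⬝ᵥ u j = if i = j then 1 else 0)
    (m : ℕ) (K r R : ℝ) (hK : 0 ≤ K) (hr : 0 < r) (hrR : r ≤ R)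
    (T : Finset (Fin n → ℤ))
    (hR : ∀ x ∈ T, ∀ x' ∈ T, ∀ k, |(x k : ℝ) - x' k| ≤ R)
    (hL : ∀ x ∈ T, ∀ x' ∈ T, ∑ a with a.val + m < n, |u a ⬝ᵥ (fun k => (x k : ℝ) - x' k)| ≤
      K * (r + ∑ a with ¬ (a.val + m < n), |u a ⬝ᵥ (fun k => (x k : ℝ) - x' k)|)) :
    ∃ T' ⊆ T, (∀ x ∈ T', ∀ x' ∈ T', ∀ k, |(x k : ℝ) - x' k| ≤ (n + K * (1 + n)) * r) ∧
      (T.card : ℝ) ≤ ((2 * n + 2) * (R / r)) ^ m * T'.card := by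
  classical
  rcases T.eq_empty_or_nonempty with rfl | ⟨x0, hx0⟩
  · exact ⟨∅, subset_rfl, by simp, by simp⟩
  obtain ⟨T', hT', hs, hc⟩ := pigR T
    (fun (a : {a : Fin n // ¬ (a.val + m < n)}) x => u a ⬝ᵥ (fun k => (x k : ℝ) - x0 k))
    (fun _ => n * (1 * R)) (fun _ => r) (fun _ => hr)
    (fun x hx a => dot_le zero_le_one (on_le_one hu a) (hR x hx x0 hx0))
  refine ⟨T', hT', ?_, ?_⟩
  · intro x hx x' hx' k
    have key : ∑ a with ¬ (a.val + m < n), |u a ⬝ᵥ (fun k => (x k : ℝ) - x' k)| ≤ n * r := by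
      calc _ ≤ ∑ a : Fin n with ¬ (a.val + m < n), r := by
            refine Finset.sum_le_sum fun a ha => ?_
            have := hs x hx x' hx' ⟨a, (Finset.mem_filter.1 ha).2⟩
            rw [← dotProduct_sub] at this
            have e : ((fun k => (x k : ℝ) - x0 k) - fun k => (x' k : ℝ) - x0 k) =
                fun k => (x k : ℝ) - x' k := by ext k; simp
            rw [e] at this
            exact this
        _ ≤ ∑ a : Fin n, r := Finset.sum_le_sum_of_subset_of_nonneg (Finset.filter_subset _ _)
            (fun _ _ _ => hr.le)
        _ = n * r := by simp
    have h1 := hL x (hT' hx) x' (hT' hx')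
    have h2 := on_norm_le hu (fun k => (x k : ℝ) - x' k)
    rw [← Finset.sum_filter_add_sum_filter_not Finset.univ (fun a : Fin n => a.val + m < n)] at h2
    have h3 := norm_le_pi_norm (fun k => (x k : ℝ) - x' k) k
    rw [Real.norm_eq_abs] at h3
    have h4 : K * (r + ∑ a with ¬ (a.val + m < n), |u a ⬝ᵥ (fun k => (x k : ℝ) - x' k)|) ≤
      K * (r + n * r) := by gcongr
    linarith
  · refine hc.trans ?_
    gcongr
    rw [Finset.prod_const]
    have hR1 : 1 ≤ R / r := by rwa [le_div_iff₀ hr, one_mul]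
    have hb : 2 * (n * (1 * R)) / r + 2 ≤ (2 * n + 2) * (R / r) := by
      have : 2 * (n * (1 * R)) / r = 2 * n * (R / r) := by ring
      rw [this]; nlinarith
    have hcard : (Finset.univ : Finset {a : Fin n // ¬ (a.val + m < n)}).card ≤ m := by
      rw [Finset.card_univ, Fintype.card_subtype]
      have : (Finset.univ.filter fun a : Fin n => ¬ (a.val + m < n)).card ≤ (Finset.Ico (n - m) n).card := by
        apply Finset.card_le_card_of_injOn (fun a => a.val)
        · intro a ha
          have := (Finset.mem_filter.1 ha).2
          simp only [Finset.coe_Ico, Set.mem_Ico]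
          omega
        · intro a _ b _ h; exact Fin.ext h
      rw [Nat.card_Ico] at this
      omega
    have h0 : (0:ℝ) ≤ 2 * (n * (1 * R)) / r + 2 := by
      have : 0 ≤ R := hr.le.trans hrR
      positivity
    calc _ ≤ ((2 * n + 2) * (R / r)) ^ (Finset.univ : Finset {a : Fin n // ¬ (a.val + m < n)}).card :=
          pow_le_pow_left₀ h0 hb _
      _ ≤ _ := by
          apply pow_le_pow_right₀ _ hcard
          have : (0:ℝ) ≤ n := Nat.cast_nonneg n
          nlinarith

/-- The dichotomy for a family of linear functionals. -/
lemma dichR {n : ℕ} {ι : Type*} [Fintype ι] (g : ι → Fin n → ℝ) (m : ℕ) (δ : ℝ) (hδ : 0 < δ) :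
    ∃ u : Fin n → Fin n → ℝ, (∀ i j, u i ⬝ᵥ u j = if i = j then 1 else 0) ∧
      ((m < n ∧ ∀ a : Fin n, n ≤ a.val + m + 1 → ∀ i, |g i ⬝ᵥ u a| ≤ δ) ∨
       (∀ a : Fin n, a.val + m < n → ∀ z, δ * |u a ⬝ᵥ z| ≤ ∑ i, |g i ⬝ᵥ z|)) := by
  set G : Matrix (Fin n) (Fin n) ℝ := ∑ i, Matrix.vecMulVec (g i) (g i) with hG
  have hGs : G.IsSymm := by
    rw [Matrix.IsSymm, hG, Matrix.transpose_sum]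
    exact Finset.sum_congr rfl fun i _ => by rw [Matrix.transpose_vecMulVec]
  obtain ⟨u, mu, hu, hmu, hanti⟩ := eigR G hGs
  have hq : ∀ y z, y ⬝ᵥ (G *ᵥ z) = ∑ i, (g i ⬝ᵥ y) * (g i ⬝ᵥ z) := by
    intro y z
    rw [hG, Matrix.sum_mulVec, dotProduct_sum]
    refine Finset.sum_congr rfl fun i _ => ?_
    rw [Matrix.vecMulVec_mulVec]
    simp [dotProduct_smul, dotProduct_comm, mul_comm]
  have hmu2 : ∀ a, mu a = ∑ i, (g i ⬝ᵥ u a) ^ 2 := by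
    intro a
    have := hq (u a) (u a)
    rw [hmu, dotProduct_smul, hu, if_pos rfl] at this
    simpa [pow_two] using this
  have hmu0 : ∀ a, 0 ≤ mu a := fun a => by rw [hmu2]; positivity
  have hgu : ∀ a i, |g i ⬝ᵥ u a| ≤ √(mu a) := by
    intro a i
    apply Real.abs_le_sqrt
    rw [hmu2]
    exact Finset.single_le_sum (f := fun i => (g i ⬝ᵥ u a) ^ 2) (fun _ _ => sq_nonneg _) (Finset.mem_univ i)
  refine ⟨u, hu, ?_⟩
  by_cases h : ∃ a : Fin n, a.val + m < n ∧ √(mu a) ≤ δ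
  · left
    obtain ⟨a, ha, hle⟩ := h
    refine ⟨by omega, fun b hb i => (hgu b i).trans (le_trans ?_ hle)⟩
    apply Real.sqrt_le_sqrt
    have := hanti a b (by rw [Fin.le_def]; omega)
    rwa [abs_of_nonneg (hmu0 _), abs_of_nonneg (hmu0 _)] at this
  · right
    push Not at h
    intro a ha z
    have hlt := h a ha
    have h1 : mu a * (u a ⬝ᵥ z) = ∑ i, (g i ⬝ᵥ u a) * (g i ⬝ᵥ z) := by
      rw [← hq, Matrix.dotProduct_mulVec, ← Matrix.mulVec_transpose, hGs.eq, hmu, smul_dotProduct, smul_eq_mul]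
    have h2 : mu a * |u a ⬝ᵥ z| ≤ √(mu a) * ∑ i, |g i ⬝ᵥ z| := by
      rw [← abs_of_nonneg (hmu0 a), ← abs_mul, h1, abs_of_nonneg (hmu0 a), Finset.mul_sum]
      refine (Finset.abs_sum_le_sum_abs _ _).trans (Finset.sum_le_sum fun i _ => ?_)
      rw [abs_mul]
      exact mul_le_mul_of_nonneg_right (hgu a i) (abs_nonneg _)
    have hpos : 0 < √(mu a) := hδ.trans hlt
    have h3 : √(mu a) * (√(mu a) * |u a ⬝ᵥ z|) ≤ √(mu a) * ∑ i, |g i ⬝ᵥ z| := by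
      rw [← mul_assoc, Real.mul_self_sqrt (hmu0 a)]; exact h2
    have h4 := le_of_mul_le_mul_left h3 hpos
    refine le_trans ?_ h4
    gcongr

/-- The trilinear form. -/
noncomputable def triR {n : ℕ} (τ : Fin n → Matrix (Fin n) (Fin n) ℝ) (z y y' : Fin n → ℝ) : ℝ :=
  ∑ k, z k * (y ⬝ᵥ (τ k *ᵥ y'))

lemma triR_eq {n : ℕ} (τ : Fin n → Matrix (Fin n) (Fin n) ℝ) (z y y' : Fin n → ℝ) :
    triR τ z y y' = y ⬝ᵥ ((∑ k, z k • τ k) *ᵥ y') := by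
  rw [Matrix.sum_mulVec, dotProduct_sum, triR]
  refine Finset.sum_congr rfl fun k _ => ?_
  rw [Matrix.smul_mulVec, dotProduct_smul, smul_eq_mul]

lemma triR_bound {n : ℕ} {τ : Fin n → Matrix (Fin n) (Fin n) ℝ} (hτ : ∀ k i j, |τ k i j| ≤ 6)
    {z y y' : Fin n → ℝ} {a b c : ℝ} (ha : 0 ≤ a) (hb : 0 ≤ b)
    (hz : ∀ i, |z i| ≤ a) (hy : ∀ i, |y i| ≤ b) (hy' : ∀ i, |y' i| ≤ c) :
    |triR τ z y y'| ≤ 6 * n ^ 3 * (a * b * c) := by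
  have h := dot_le (z := fun k => (y ⬝ᵥ (τ k *ᵥ y'))) ha hz
    (fun k => dot_le hb hy (fun i => dot_le (by norm_num) (hτ k i) hy'))
  have e : (z ⬝ᵥ fun k => (y ⬝ᵥ (τ k *ᵥ y'))) = triR τ z y y' := rfl
  rw [e] at h
  refine h.trans (le_of_eq ?_)
  ring

lemma triR_sub2 {n : ℕ} (τ : Fin n → Matrix (Fin n) (Fin n) ℝ) (z y₁ y₂ y' : Fin n → ℝ) :
    triR τ z (y₁ - y₂) y' = triR τ z y₁ y' - triR τ z y₂ y' := by
  simp only [triR, sub_dotProduct, mul_sub, Finset.sum_sub_distrib]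

lemma triR_sub3 {n : ℕ} (τ : Fin n → Matrix (Fin n) (Fin n) ℝ) (z y y₁ y₂ : Fin n → ℝ) :
    triR τ z y (y₁ - y₂) = triR τ z y y₁ - triR τ z y y₂ := by
  simp only [triR, Matrix.mulVec_sub, dotProduct_sub, mul_sub, Finset.sum_sub_distrib]

lemma triR_sub1 {n : ℕ} (τ : Fin n → Matrix (Fin n) (Fin n) ℝ) (z₁ z₂ y y' : Fin n → ℝ) :
    triR τ (z₁ - z₂) y y' = triR τ z₁ y y' - triR τ z₂ y y' := by
  simp only [triR, Pi.sub_apply, sub_mul, Finset.sum_sub_distrib]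

lemma triR_symm {n : ℕ} {τ : Fin n → Matrix (Fin n) (Fin n) ℝ} (hs : ∀ k, (τ k).IsSymm)
    (z y y' : Fin n → ℝ) : triR τ z y y' = triR τ z y' y := by
  refine Finset.sum_congr rfl fun k _ => ?_
  rw [Matrix.dotProduct_mulVec, ← Matrix.mulVec_transpose, (hs k).eq, dotProduct_comm]

lemma triR_expand {n : ℕ} (τ : Fin n → Matrix (Fin n) (Fin n) ℝ) (z : Fin n → ℝ)
    (a b : Fin n → ℝ) (w : Fin n → Fin n → ℝ) :
    triR τ z (∑ i, a i • w i) (∑ i, b i • w i) = ∑ i, ∑ l, a i * b l * triR τ z (w i) (w l) := by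
  simp only [triR_eq, sum_dotProduct, Matrix.mulVec_sum, dotProduct_sum, smul_dotProduct,
    Matrix.mulVec_smul, dotProduct_smul, smul_eq_mul]
  rw [Finset.sum_comm (γ := Fin n)]
  refine Finset.sum_congr rfl fun k _ => ?_
  rw [Finset.mul_sum]
  refine Finset.sum_congr rfl fun l _ => ?_
  ring

lemma triR_eig {n : ℕ} {τ : Fin n → Matrix (Fin n) (Fin n) ℝ} (z y v : Fin n → ℝ) (c : ℝ)
    (h : (∑ k, z k • τ k) *ᵥ v = c • v) : triR τ z y v = c * (y ⬝ᵥ v) := by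
  rw [triR_eq, h, dotProduct_smul, smul_eq_mul]

lemma stepR {n : ℕ} {τ : Fin n → Matrix (Fin n) (Fin n) ℝ} (hτ : ∀ k i j, |τ k i j| ≤ 6)
    (hs : ∀ k, (τ k).IsSymm) (C : ℝ) (hC : 1 ≤ C) (S : Finset (Fin n → ℤ))
    (v : (Fin n → ℤ) → Fin n → Fin n → ℝ) (lam : (Fin n → ℤ) → Fin n → ℝ)
    (hv : ∀ x i j, v x i ⬝ᵥ v x j = if i = j then 1 else 0)
    (hlam : ∀ x i, (∑ k, (x k : ℝ) • τ k) *ᵥ v x i = lam x i • v x i)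
    (w : Fin n → Fin n → ℝ) (hw : ∀ i j, w i ⬝ᵥ w j = if i = j then 1 else 0)
    (hvw : ∀ x ∈ S, ∀ i k, |w i k - v x i k| ≤ 1 / C)
    (j : ℕ) (hj : j < n) (r : ℝ) (hr : 0 < r) (hE : ∀ x ∈ S, ∀ i : Fin n, j ≤ i.val → |lam x i| ≤ 2 * r)
    (σ : ℕ) :
    (∃ X Y : Submodule ℝ (Fin n → ℝ),
            0 < Module.finrank ℝ X ∧ 0 < Module.finrank ℝ Y ∧
            Module.finrank ℝ X + Module.finrank ℝ Y = n + σ + 1 ∧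
            ∀ x ∈ X, ∀ y ∈ Y, ∀ y' ∈ Y,
              |triR τ x y y'| ≤ 24 * (n + 1) ^ 12 * C⁻¹ * ‖y‖ * ‖x‖ * ‖y'‖) ∨
    (∃ u : Fin n → Fin n → ℝ, (∀ i j, u i ⬝ᵥ u j = if i = j then 1 else 0) ∧
      ∀ x ∈ S, ∀ x' ∈ S,
       ∑ a with a.val + (σ + j) < n, |u a ⬝ᵥ (fun k => (x k : ℝ) - x' k)| ≤
      C * (r + ∑ a with ¬ (a.val + (σ + j) < n), |u a ⬝ᵥ (fun k => (x k : ℝ) - x' k)|)) := by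
  classical
  have hC0 : 0 < C := by linarith
  set N : ℝ := n + 1 with hN
  have hn0 : (0:ℝ) ≤ n := Nat.cast_nonneg n
  have hN1 : 1 ≤ N := by linarith
  have hnN : (n:ℝ) ≤ N := by linarith
  set δ : ℝ := 24 * N ^ 6 / C with hδ
  have hδ0 : 0 < δ := by positivity
  obtain ⟨u, hu, h | h⟩ := dichR (fun (p : {i : Fin n // j ≤ i.val} × {i : Fin n // j ≤ i.val}) k =>
    w p.1 ⬝ᵥ (τ k *ᵥ w p.2)) (σ + j) δ hδ0
  · left
    obtain ⟨hm, h⟩ := h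
    have hg : ∀ (i l : Fin n) z, (fun k => w i ⬝ᵥ (τ k *ᵥ w l)) ⬝ᵥ z = triR τ z (w i) (w l) := by
      intro i l z
      rw [dotProduct_comm]; rfl
    refine ⟨Submodule.span ℝ (Set.range fun i : {i : Fin n // n ≤ i.val + (σ + j) + 1} => u i),
      Submodule.span ℝ (Set.range fun i : {i : Fin n // j ≤ i.val} => w i), ?_⟩
    rw [on_span_dim hu, on_span_dim hw]
    have c1 : Fintype.card {i : Fin n // n ≤ i.val + (σ + j) + 1} = σ + j + 1 := by
      rw [Fintype.card_subtype]
      have : (Finset.univ.filter fun a : Fin n => n ≤ a.val + (σ + j) + 1) =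
          Finset.Ici ⟨n - (σ + j + 1), by omega⟩ := by
        ext a
        simp only [Finset.mem_filter, Finset.mem_univ, true_and, Finset.mem_Ici, Fin.le_def]
        omega
      rw [this, Fin.card_Ici]
      simp only
      omega
    have c2 : Fintype.card {i : Fin n // j ≤ i.val} = n - j := by
      rw [Fintype.card_subtype]
      have : (Finset.univ.filter fun a : Fin n => j ≤ a.val) = Finset.Ici ⟨j, hj⟩ := by
        ext a
        simp [Fin.le_def]
      rw [this, Fin.card_Ici]
    rw [c1, c2]
    refine ⟨by omega, by omega, by omega, ?_⟩
    intro x hx y hy y' hy'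
    have hco : ∀ (q : Fin n → Fin n → ℝ), (∀ i j, q i ⬝ᵥ q j = if i = j then 1 else 0) →
        ∀ i z, |q i ⬝ᵥ z| ≤ n * ‖z‖ := by
      intro q hq i z
      have := dot_le zero_le_one (on_le_one hq i) (fun k => norm_le_pi_norm z k)
      simpa using this
    have hgx : ∀ i l : Fin n, j ≤ i.val → j ≤ l.val → |triR τ x (w i) (w l)| ≤ n ^ 2 * δ * ‖x‖ := by
      intro i l hi hl
      rw [← hg]
      conv_lhs => rw [on_expand hu x]
      rw [dotProduct_sum]
      refine (Finset.abs_sum_le_sum_abs _ _).trans ?_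
      calc _ ≤ ∑ b : Fin n, (n * ‖x‖) * δ := by
            refine Finset.sum_le_sum fun b _ => ?_
            rw [dotProduct_smul, smul_eq_mul]
            by_cases hb : n ≤ b.val + (σ + j) + 1
            · rw [abs_mul]
              exact mul_le_mul (hco u hu b x) (h b hb ⟨⟨i, hi⟩, ⟨l, hl⟩⟩) (abs_nonneg _) (by positivity)
            · rw [on_span_zero hu _ hx b hb]
              simp only [zero_mul, abs_zero]
              positivity
        _ = n ^ 2 * δ * ‖x‖ := by simp; ring
    rw [on_expand hw y, on_expand hw y', triR_expand, ← on_expand hw y, ← on_expand hw y']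
    have hterm : ∀ i l, |(w i ⬝ᵥ y) * (w l ⬝ᵥ y') * triR τ x (w i) (w l)| ≤
        (n * ‖y‖) * (n * ‖y'‖) * (n ^ 2 * δ * ‖x‖) := by
      intro i l
      by_cases hi : j ≤ i.val
      · by_cases hl : j ≤ l.val
        · rw [abs_mul, abs_mul]
          exact mul_le_mul (mul_le_mul (hco w hw i y) (hco w hw l y') (abs_nonneg _) (by positivity))
            (hgx i l hi hl) (abs_nonneg _) (by positivity)
        · rw [on_span_zero hw _ hy' l hl]
          simp only [mul_zero, zero_mul, abs_zero]; positivity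
      · rw [on_span_zero hw _ hy i hi]
        simp only [zero_mul, abs_zero]; positivity
    calc _ ≤ ∑ i : Fin n, ∑ l : Fin n, (n * ‖y‖) * (n * ‖y'‖) * (n ^ 2 * δ * ‖x‖) := by
          refine (Finset.abs_sum_le_sum_abs _ _).trans (Finset.sum_le_sum fun i _ => ?_)
          exact (Finset.abs_sum_le_sum_abs _ _).trans (Finset.sum_le_sum fun l _ => hterm i l)
      _ = (n:ℝ) ^ 6 * (24 * N ^ 6 * C⁻¹ * ‖y‖ * ‖x‖ * ‖y'‖) := by
          simp only [Finset.sum_const, Finset.card_univ, Fintype.card_fin, nsmul_eq_mul, hδ]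
          ring
      _ ≤ N ^ 6 * (24 * N ^ 6 * C⁻¹ * ‖y‖ * ‖x‖ * ‖y'‖) := by gcongr
      _ = _ := by ring
  · right
    refine ⟨u, hu, ?_⟩
    intro x hx x' hx'
    set z : Fin n → ℝ := fun k => (x k : ℝ) - x' k with hz
    have hz' : z = (fun k => (x k : ℝ)) - (fun k => (x' k : ℝ)) := rfl
    have hg : ∀ i l : Fin n, j ≤ i.val → j ≤ l.val →
        |triR τ z (w i) (w l)| ≤ 4 * n * r + 12 * n ^ 3 * ‖z‖ / C := by
      intro i l hi hl
      have hd : |v x i ⬝ᵥ v x' l| ≤ n := by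
        have := dot_le zero_le_one (on_le_one (hv x) i) (on_le_one (hv x') l)
        simpa using this
      have t1 : |triR τ (fun k => (x k : ℝ)) (v x i) (v x' l)| ≤ 2 * r * n := by
        rw [triR_symm hs, triR_eig _ _ _ _ (hlam x i), abs_mul, dotProduct_comm]
        exact mul_le_mul (hE x hx i hi) hd (abs_nonneg _) (by positivity)
      have t2 : |triR τ (fun k => (x' k : ℝ)) (v x i) (v x' l)| ≤ 2 * r * n := by
        rw [triR_eig _ _ _ _ (hlam x' l), abs_mul]
        exact mul_le_mul (hE x' hx' l hl) hd (abs_nonneg _) (by positivity)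
      have t3 : |triR τ z (w i - v x i) (w l)| ≤ 6 * n ^ 3 * (‖z‖ * (1 / C) * 1) :=
        triR_bound hτ (norm_nonneg _) (by positivity) (fun k => norm_le_pi_norm z k)
          (fun k => hvw x hx i k) (on_le_one hw l)
      have t4 : |triR τ z (v x i) (w l - v x' l)| ≤ 6 * n ^ 3 * (‖z‖ * 1 * (1 / C)) :=
        triR_bound hτ (norm_nonneg _) (by positivity) (fun k => norm_le_pi_norm z k)
          (on_le_one (hv x) i) (fun k => hvw x' hx' l k)
      have e : triR τ z (w i) (w l) = triR τ z (w i - v x i) (w l) + triR τ z (v x i) (w l - v x' l)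
          + (triR τ (fun k => (x k : ℝ)) (v x i) (v x' l) - triR τ (fun k => (x' k : ℝ)) (v x i) (v x' l)) := by
        rw [← triR_sub1, ← hz', triR_sub2, triR_sub3]; ring
      rw [e]
      have e2 : 12 * (n:ℝ) ^ 3 * ‖z‖ / C = 6 * n ^ 3 * (‖z‖ * (1 / C) * 1) + 6 * n ^ 3 * (‖z‖ * 1 * (1 / C)) := by ring
      rw [e2]
      rw [abs_le] at *
      constructor <;> linarith [t1.1, t1.2, t2.1, t2.2, t3.1, t3.2, t4.1, t4.2]
    have hsum : ∀ a : Fin n, a.val + (σ + j) < n → |u a ⬝ᵥ z| ≤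
        (n ^ 2 * (4 * n * r + 12 * n ^ 3 * ‖z‖ / C)) / δ := by
      intro a ha
      rw [le_div_iff₀ hδ0, mul_comm]
      refine (h a ha z).trans ?_
      calc _ ≤ ∑ p : {i : Fin n // j ≤ i.val} × {i : Fin n // j ≤ i.val}, (4 * n * r + 12 * n ^ 3 * ‖z‖ / C) := by
            refine Finset.sum_le_sum fun p _ => ?_
            have := hg p.1 p.2 p.1.2 p.2.2
            rw [triR] at this
            rw [dotProduct_comm]; exact this
        _ ≤ _ := by
            rw [Finset.sum_const, nsmul_eq_mul]
            gcongr
            rw [Finset.card_univ, Fintype.card_prod]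
            have : Fintype.card {i : Fin n // j ≤ i.val} ≤ n := by
              simpa using Fintype.card_subtype_le (fun i : Fin n => j ≤ i.val)
            push_cast
            rw [pow_two]
            have h' : (Fintype.card {i : Fin n // j ≤ i.val} : ℝ) ≤ n := by exact_mod_cast this
            gcongr
    have hSQ : ∑ a with a.val + (σ + j) < n, |u a ⬝ᵥ z| ≤ C * r / 2 + ‖z‖ / 2 := by
      calc _ ≤ ∑ a : Fin n with a.val + (σ + j) < n, (n ^ 2 * (4 * n * r + 12 * n ^ 3 * ‖z‖ / C)) / δ :=
            Finset.sum_le_sum fun a ha => hsum a (Finset.mem_filter.1 ha).2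
        _ ≤ ∑ a : Fin n, (n ^ 2 * (4 * n * r + 12 * n ^ 3 * ‖z‖ / C)) / δ :=
            Finset.sum_le_sum_of_subset_of_nonneg (Finset.filter_subset _ _) (fun _ _ _ => by positivity)
        _ = (4 * (n:ℝ) ^ 4 * (C * r) + 12 * n ^ 6 * ‖z‖) / (24 * N ^ 6) := by
            simp only [Finset.sum_const, Finset.card_univ, Fintype.card_fin, nsmul_eq_mul, hδ]
            field_simp
        _ ≤ (12 * N ^ 6 * (C * r) + 12 * N ^ 6 * ‖z‖) / (24 * N ^ 6) := by
            have h46 : (n:ℝ) ^ 4 ≤ N ^ 6 :=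
              (pow_le_pow_left₀ hn0 hnN 4).trans (pow_le_pow_right₀ hN1 (by norm_num))
            have : 4 * (n:ℝ) ^ 4 ≤ 12 * N ^ 6 := by nlinarith [pow_nonneg hn0 4]
            gcongr
        _ = _ := by field_simp; ring
    have h2 := on_norm_le hu z
    rw [← Finset.sum_filter_add_sum_filter_not Finset.univ (fun a : Fin n => a.val + (σ + j) < n)] at h2
    have h3 : 0 ≤ ∑ a with ¬ (a.val + (σ + j) < n), |u a ⬝ᵥ z| := Finset.sum_nonneg fun _ _ => abs_nonneg _
    nlinarith

lemma chainR (n : ℕ) (K0 : ℝ) (hK0 : 1 ≤ K0) {α : Type} : ∀ j : ℕ, ∃ K : ℝ, 1 ≤ K ∧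
    ∀ (T : Finset α) (F : ℕ → ℝ) (σ : ℕ) (D : Finset α → ℝ → Prop), σ ≤ n → (∀ j, 0 < F j) →
    (∀ j, F (j + 1) ≤ F j) → D T (K0 * F 0) →
    (∀ j, ∀ T' ⊆ T, ∀ R, F (j + 1) ≤ R → D T' R → ∃ T'' ⊆ T', D T'' (K0 * F (j + 1)) ∧
      (T'.card : ℝ) ≤ (K0 * (R / F (j + 1))) ^ (σ + j) * T''.card) →
    ∃ T' ⊆ T, D T' (K0 * F j) ∧
      (T.card : ℝ) * F j ^ (σ + j) ≤ K * (F 0 ^ σ * ∏ i ∈ Finset.range j, F (i + 1)) * T'.card := by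
  intro j
  induction j with
  | zero =>
    refine ⟨1, le_rfl, ?_⟩
    intro T F σ D _ _ _ hD _
    exact ⟨T, subset_rfl, hD, by simp [mul_comm]⟩
  | succ j ih =>
    obtain ⟨K, hK, ih⟩ := ih
    refine ⟨K * (K0 ^ 2) ^ (n + j), ?_, ?_⟩
    · exact one_le_mul_of_one_le_of_one_le hK (one_le_pow₀ (one_le_pow₀ hK0))
    intro T F σ D hσ hF hanti hD hstep
    obtain ⟨T', hT', hD', hc⟩ := ih T F σ D hσ hF hanti hD hstep
    have hFj := hF j
    have hFj1 := hF (j + 1)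
    obtain ⟨T'', hT'', hD'', hc'⟩ := hstep j T' hT' (K0 * F j)
      ((hanti j).trans (le_mul_of_one_le_left hFj.le hK0)) hD'
    refine ⟨T'', hT''.trans hT', hD'', ?_⟩
    have hP : 0 ≤ F 0 ^ σ * ∏ i ∈ Finset.range j, F (i + 1) :=
      mul_nonneg (pow_nonneg (hF 0).le _) (Finset.prod_nonneg fun i _ => (hF _).le)
    have hK0p : 0 < K0 := by linarith
    rw [Finset.prod_range_succ]
    set P := F 0 ^ σ * ∏ i ∈ Finset.range j, F (i + 1) with hPdef
    have e1 : (K0 * (K0 * F j / F (j + 1))) ^ (σ + j) = (K0 ^ 2) ^ (σ + j) * F j ^ (σ + j) / F (j + 1) ^ (σ + j) := by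
      rw [← mul_pow, ← div_pow]; congr 1; ring
    rw [e1] at hc'
    have hpos : 0 < F j ^ (σ + j) := pow_pos hFj _
    have hpos1 : 0 < F (j + 1) ^ (σ + j) := pow_pos hFj1 _
    rw [div_mul_eq_mul_div, le_div_iff₀ hpos1] at hc'
    have h1 : ((T.card : ℝ) * F (j + 1) ^ (σ + (j + 1))) * F j ^ (σ + j) ≤
        (K * (K0 ^ 2) ^ (σ + j) * (P * F (j + 1)) * T''.card) * F j ^ (σ + j) := by
      calc _ = ((T.card : ℝ) * F j ^ (σ + j)) * F (j + 1) ^ (σ + j) * F (j + 1) := by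
            rw [← add_assoc, pow_succ]; ring
        _ ≤ (K * P * T'.card) * F (j + 1) ^ (σ + j) * F (j + 1) := by gcongr
        _ = K * P * F (j + 1) * (T'.card * F (j + 1) ^ (σ + j)) := by ring
        _ ≤ K * P * F (j + 1) * ((K0 ^ 2) ^ (σ + j) * F j ^ (σ + j) * T''.card) := by gcongr
        _ = _ := by ring
    have h2 := le_of_mul_le_mul_right h1 hpos
    refine h2.trans ?_
    have h3 : (K0 ^ 2) ^ (σ + j) ≤ (K0 ^ 2) ^ (n + j) :=
      pow_le_pow_right₀ (one_le_pow₀ hK0) (by omega)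
    have e : F 0 ^ σ * ((∏ i ∈ Finset.range j, F (i + 1)) * F (j + 1)) = P * F (j + 1) := by
      rw [hPdef]; ring
    rw [e]
    gcongr

lemma coreR (n : ℕ) (C : ℝ) (hC : 1 ≤ C) : ∃ K : ℝ, 1 ≤ K ∧
    ∀ (τ : Fin n → Matrix (Fin n) (Fin n) ℝ), (∀ k i j, |τ k i j| ≤ 6) →
    (∀ k, (τ k).IsSymm) → ∀ (S : Finset (Fin n → ℤ))
    (v : (Fin n → ℤ) → Fin n → Fin n → ℝ) (lam : (Fin n → ℤ) → Fin n → ℝ),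
    (∀ x i j, v x i ⬝ᵥ v x j = if i = j then 1 else 0) →
    (∀ x i, (∑ k, (x k : ℝ) • τ k) *ᵥ v x i = lam x i • v x i) →
    ∀ (w : Fin n → Fin n → ℝ), (∀ i j, w i ⬝ᵥ w j = if i = j then 1 else 0) →
    (∀ x ∈ S, ∀ i k, |w i k - v x i k| ≤ 1 / C) →
    ∀ (E : Fin n → ℝ) (F0 : ℝ), (∀ i j, i ≤ j → E j ≤ E i) → (∀ i, 1 ≤ E i) → (∀ i, E i ≤ F0) → 1 ≤ F0 →
    (∀ x ∈ S, ∀ i, |lam x i| ≤ 2 * E i) →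
    (∀ x ∈ S, ∀ x' ∈ S, ∀ k, |(x k : ℝ) - x' k| ≤ F0) →
    ∀ σ ≤ n,
    (∃ X Y : Submodule ℝ (Fin n → ℝ),
            0 < Module.finrank ℝ X ∧ 0 < Module.finrank ℝ Y ∧
            Module.finrank ℝ X + Module.finrank ℝ Y = n + σ + 1 ∧
            ∀ x ∈ X, ∀ y ∈ Y, ∀ y' ∈ Y,
              |triR τ x y y'| ≤ 24 * (n + 1) ^ 12 * C⁻¹ * ‖y‖ * ‖x‖ * ‖y'‖) ∨
    (S.card : ℝ) ≤ K * F0 ^ σ * ∏ i, E i := by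
  have hn0 : (0:ℝ) ≤ n := Nat.cast_nonneg n
  set K0 : ℝ := 2 * (n + 1) * (C + 1) with hK0
  have hK0a : n + C * (1 + n) ≤ K0 := by rw [hK0]; nlinarith
  have hK0b : 2 * (n:ℝ) + 2 ≤ K0 := by rw [hK0]; nlinarith
  have hK01 : 1 ≤ K0 := by linarith
  obtain ⟨K, hK, hchain⟩ := chainR n K0 hK01 (α := Fin n → ℤ) (n + 1)
  have hQ1 : (1:ℝ) ≤ (2 * K0 / (1 / 2) + 2) ^ n := one_le_pow₀ (by
    have : (2 * K0 / (1 / 2) + 2) = 4 * K0 + 2 := by ring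
    linarith)
  refine ⟨K * (2 * K0 / (1 / 2) + 2) ^ n, one_le_mul_of_one_le_of_one_le hK hQ1, ?_⟩
  intro τ hτ hs S v lam hv hlam w hw hvw E F0 hEanti hE1 hEF hF1 hEl hdiam σ hσ
  by_cases hb : ∃ X Y : Submodule ℝ (Fin n → ℝ),
            0 < Module.finrank ℝ X ∧ 0 < Module.finrank ℝ Y ∧
            Module.finrank ℝ X + Module.finrank ℝ Y = n + σ + 1 ∧
            ∀ x ∈ X, ∀ y ∈ Y, ∀ y' ∈ Y,
              |triR τ x y y'| ≤ 24 * (n + 1) ^ 12 * C⁻¹ * ‖y‖ * ‖x‖ * ‖y'‖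
  · exact Or.inl hb
  right
  let F : ℕ → ℝ := fun j => match j with
    | 0 => F0
    | j + 1 => if h : j < n then E ⟨j, h⟩ else 1
  have hFs : ∀ j, F (j + 1) = if h : j < n then E ⟨j, h⟩ else 1 := fun j => rfl
  have hF0 : F 0 = F0 := rfl
  have hFge : ∀ j, 1 ≤ F j := by
    intro j
    cases j with
    | zero => exact hF1
    | succ j =>
      rw [hFs]; split_ifs
      · exact hE1 _
      · exact le_rfl
  have hFpos : ∀ j, 0 < F j := fun j => by linarith [hFge j]
  have hFa : ∀ j, F (j + 1) ≤ F j := by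
    intro j
    by_cases h : j < n
    · rw [hFs, dif_pos h]
      cases j with
      | zero => exact hEF _
      | succ j =>
        rw [hFs, dif_pos (by omega)]
        exact hEanti _ _ (by rw [Fin.le_def]; simp)
    · rw [hFs, dif_neg h]; exact hFge j
  obtain ⟨T', hT', hD, hc⟩ := hchain S F σ
    (fun T R => ∀ x ∈ T, ∀ x' ∈ T, ∀ k, |(x k : ℝ) - x' k| ≤ R) hσ hFpos hFa
    (fun x hx x' hx' k => (hdiam x hx x' hx' k).trans (by rw [hF0]; nlinarith)) (by
      intro j T' hT' R hR hdR
      have hu : ∃ u : Fin n → Fin n → ℝ, (∀ i j, u i ⬝ᵥ u j = if i = j then 1 else 0) ∧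
          ∀ x ∈ S, ∀ x' ∈ S,
           ∑ a with a.val + (σ + j) < n, |u a ⬝ᵥ (fun k => (x k : ℝ) - x' k)| ≤
          C * (F (j + 1) + ∑ a with ¬ (a.val + (σ + j) < n), |u a ⬝ᵥ (fun k => (x k : ℝ) - x' k)|) := by
        by_cases hj : j < n
        · refine (stepR hτ hs C hC S v lam hv hlam w hw hvw j hj (F (j + 1)) (hFpos (j + 1)) ?_ σ).resolve_left hb
          intro x hx i hi
          refine (hEl x hx i).trans ?_
          rw [hFs, dif_pos hj]
          have := hEanti ⟨j, hj⟩ i (by rw [Fin.le_def]; exact hi)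
          linarith
        · refine ⟨w, hw, ?_⟩
          intro x hx x' hx'
          rw [Finset.sum_eq_zero]
          · have := hFpos (j + 1)
            have h0 : 0 ≤ ∑ a with ¬ (a.val + (σ + j) < n), |w a ⬝ᵥ (fun k => (x k : ℝ) - x' k)| :=
              Finset.sum_nonneg fun _ _ => abs_nonneg _
            positivity
          · intro a ha
            have := (Finset.mem_filter.1 ha).2
            omega
      obtain ⟨u, hu, hL⟩ := hu
      obtain ⟨T'', hT'', h1, h2⟩ := geoR hu (σ + j) C (F (j + 1)) R (by linarith) (hFpos (j + 1)) hR T' hdR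
        (fun x hx x' hx' => hL x (hT' hx) x' (hT' hx'))
      refine ⟨T'', hT'', ?_, ?_⟩
      · intro x hx x' hx' k
        exact (h1 x hx x' hx' k).trans (mul_le_mul_of_nonneg_right hK0a (hFpos (j + 1)).le)
      · refine h2.trans ?_
        have : 0 ≤ R / F (j + 1) := div_nonneg ((hFpos (j + 1)).le.trans hR) (hFpos (j + 1)).le
        gcongr)
  have hlast : F (n + 1) = 1 := by rw [hFs, dif_neg (lt_irrefl n)]
  have hprod : ∏ i ∈ Finset.range (n + 1), F (i + 1) = ∏ i, E i := by
    rw [Finset.prod_range_succ, hlast, mul_one, ← Fin.prod_univ_eq_prod_range (fun i => F (i + 1))]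
    refine Finset.prod_congr rfl fun i _ => ?_
    rw [hFs, dif_pos i.2]
  rw [hlast, one_pow, mul_one, hprod, hF0] at hc
  have hcT : (T'.card : ℝ) ≤ (2 * K0 / (1 / 2) + 2) ^ n := by
    rcases T'.eq_empty_or_nonempty with rfl | ⟨x0, hx0⟩
    · simp only [Finset.card_empty, Nat.cast_zero]; linarith
    obtain ⟨T'', hT'', hd, hcard⟩ := pigR T' (fun k x => (x k : ℝ) - x0 k) (fun _ => K0) (fun _ => 1 / 2)
      (fun _ => by norm_num) (fun x hx k => by
        have := hD x hx x0 hx0 k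
        rwa [hlast, mul_one] at this)
    have h1 : T''.card ≤ 1 := by
      rw [Finset.card_le_one]
      intro a ha b hb
      ext k
      have := hd a ha b hb k
      have e : (a k : ℝ) - x0 k - (b k - x0 k) = ((a k - b k : ℤ) : ℝ) := by push_cast; ring
      rw [e] at this
      have h2 : |((a k - b k : ℤ) : ℝ)| < 1 := by linarith
      have h3 : |a k - b k| < 1 := by exact_mod_cast h2
      have := Int.abs_lt_one_iff.1 h3
      omega
    have h1' : (T''.card : ℝ) ≤ 1 := by exact_mod_cast h1
    rw [Finset.prod_const, Finset.card_univ, Fintype.card_fin] at hcard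
    refine hcard.trans ?_
    nlinarith
  have hEp : 0 ≤ ∏ i, E i := Finset.prod_nonneg fun i _ => by linarith [hE1 i]
  calc (S.card : ℝ) ≤ _ := hc
    _ ≤ K * (F0 ^ σ * ∏ i, E i) * (2 * K0 / (1 / 2) + 2) ^ n := by gcongr
    _ = _ := by ring

lemma fibR {n : ℕ} {A : Matrix (Fin n) (Fin n) ℝ} (hA : A.IsSymm) {v : Fin n → Fin n → ℝ}
    {lam : Fin n → ℝ} (hv : ∀ i j, v i ⬝ᵥ v j = if i = j then 1 else 0)
    (hl : ∀ i, A *ᵥ v i = lam i • v i) (B : ℝ) (hB : 0 < B) (E : Fin n → ℝ) (hE1 : ∀ i, 1 ≤ E i)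
    (hEF : ∀ i, E i ≤ 6 * (n + 1) ^ 3 * B) (hEl : ∀ i, E i ≤ 2 * max 1 |lam i|)
    (Y : Finset (Fin n → ℤ)) (hY1 : ∀ y ∈ Y, ∀ i, |(y i : ℝ)| ≤ B)
    (hY2 : ∀ y ∈ Y, ∀ i, |(A *ᵥ (fun k => (y k : ℝ))) i| ≤ B) :
    (Y.card : ℝ) ≤ ∏ i, (16 * (n + 1) ^ 3 * B / E i) := by
  have hn0 : (0:ℝ) ≤ n := Nat.cast_nonneg n
  have hEpos : ∀ i, 0 < E i := fun i => by linarith [hE1 i]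
  obtain ⟨Y', hY', hd, hc⟩ := pigR Y (fun i y => v i ⬝ᵥ (fun k => (y k : ℝ)))
    (fun i => 2 * n * B / E i) (fun _ => 1 / ((n:ℝ) + 1)) (fun _ => by positivity) (by
      intro y hy i
      have h1 : |v i ⬝ᵥ (fun k => (y k : ℝ))| ≤ n * (1 * B) :=
        dot_le zero_le_one (on_le_one hv i) (hY1 y hy)
      have h2 : |v i ⬝ᵥ (A *ᵥ (fun k => (y k : ℝ)))| ≤ n * (1 * B) :=
        dot_le zero_le_one (on_le_one hv i) (hY2 y hy)
      rw [Matrix.dotProduct_mulVec, ← Matrix.mulVec_transpose, hA.eq, hl, smul_dotProduct,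
        smul_eq_mul, abs_mul] at h2
      rw [le_div_iff₀ (hEpos i)]
      have h3 : max 1 |lam i| * |v i ⬝ᵥ (fun k => (y k : ℝ))| ≤ n * (1 * B) := by
        rcases max_choice 1 |lam i| with h | h
        · rw [h, one_mul]; exact h1
        · rw [h]; exact h2
      nlinarith [hEl i, abs_nonneg (v i ⬝ᵥ (fun k => (y k : ℝ)))])
  have h1 : Y'.card ≤ 1 := by
    rw [Finset.card_le_one]
    intro a ha b hb
    have h := on_norm_le hv ((fun k => (a k : ℝ)) - fun k => (b k : ℝ))
    have hsum : ∑ i, |v i ⬝ᵥ ((fun k => (a k : ℝ)) - fun k => (b k : ℝ))| ≤ n * (1 / ((n:ℝ) + 1)) := by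
      calc _ ≤ ∑ i : Fin n, (1 / ((n:ℝ) + 1)) := by
            refine Finset.sum_le_sum fun i _ => ?_
            rw [dotProduct_sub]
            exact hd a ha b hb i
        _ = _ := by simp
    have hlt : n * (1 / ((n:ℝ) + 1)) < 1 := by
      rw [mul_one_div, div_lt_one (by positivity)]; linarith
    ext k
    have hk := norm_le_pi_norm ((fun k => (a k : ℝ)) - fun k => (b k : ℝ)) k
    have h2 : |((a k - b k : ℤ) : ℝ)| < 1 := by
      push_cast
      rw [Real.norm_eq_abs, Pi.sub_apply] at hk
      linarith
    have h3 : |a k - b k| < 1 := by exact_mod_cast h2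
    have := Int.abs_lt_one_iff.1 h3
    omega
  have h1' : (Y'.card : ℝ) ≤ 1 := by exact_mod_cast h1
  have hp : ∏ i : Fin n, (2 * (2 * n * B / E i) / (1 / ((n:ℝ) + 1)) + 2) ≤ ∏ i, (16 * (n + 1) ^ 3 * B / E i) := by
    apply Finset.prod_le_prod
    · intro i _
      have := hEpos i
      positivity
    · intro i _
      have := hEpos i
      have e : 2 * (2 * n * B / E i) / (1 / ((n:ℝ) + 1)) + 2 = (4 * n * (n + 1) * B + 2 * E i) / E i := by
        field_simp; ring
      rw [e]
      apply div_le_div_of_nonneg_right _ this.le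
      have h4 : 4 * n * ((n:ℝ) + 1) ≤ 4 * (n + 1) ^ 3 := by
        nlinarith [pow_nonneg hn0 3, pow_nonneg hn0 2]
      nlinarith [hEF i]
  have hp0 : 0 ≤ ∏ i : Fin n, (2 * (2 * n * B / E i) / (1 / ((n:ℝ) + 1)) + 2) :=
    Finset.prod_nonneg fun i _ => by have := hEpos i; positivity
  refine (hc.trans ?_).trans hp
  exact mul_le_of_le_one_right hp0 h1'

lemma logcmp {a b : ℝ} (ha : 1 ≤ a) (hb : 1 ≤ b) (h : |Real.log a - Real.log b| ≤ Real.log 2) :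
    a ≤ 2 * b := by
  have h1 := (abs_le.1 h).2
  have h2 : Real.log a ≤ Real.log (2 * b) := by
    rw [Real.log_mul (by norm_num) (by linarith)]; linarith
  exact (Real.log_le_log_iff (by linarith) (by linarith)).1 h2

lemma absR (n : ℕ) (C : ℝ) (hC : 1 ≤ C) : ∃ A : ℝ, 0 < A ∧
    ∀ (τ : Fin n → Matrix (Fin n) (Fin n) ℝ), (∀ k i j, |τ k i j| ≤ 6) →
    (∀ k, (τ k).IsSymm) → ∀ B : ℝ, 2 ≤ B → ∀ σ ≤ n, ∀ P : Finset ((Fin n → ℤ) × (Fin n → ℤ)),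
    (∀ p ∈ P, (∀ i, |(p.1 i : ℝ)| ≤ B) ∧ (∀ i, |(p.2 i : ℝ)| ≤ B) ∧
      ∀ i, |((∑ k, (p.1 k : ℝ) • τ k) *ᵥ (fun k => (p.2 k : ℝ))) i| ≤ B) →
    (P.card : ℝ) ≤ A * B ^ (n + σ) * Real.log B ^ n ∨
    (∃ X Y : Submodule ℝ (Fin n → ℝ),
            0 < Module.finrank ℝ X ∧ 0 < Module.finrank ℝ Y ∧
            Module.finrank ℝ X + Module.finrank ℝ Y = n + σ + 1 ∧
            ∀ x ∈ X, ∀ y ∈ Y, ∀ y' ∈ Y,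
              |triR τ x y y'| ≤ 24 * (n + 1) ^ 12 * C⁻¹ * ‖y‖ * ‖x‖ * ‖y'‖) := by
  classical
  obtain ⟨K, hK, hcore⟩ := coreR n C hC
  have hn0 : (0:ℝ) ≤ n := Nat.cast_nonneg n
  have hC0 : 0 < C := by linarith
  set Q : ℝ := 6 * (n + 1) ^ 3 with hQ
  have hN3 : (1:ℝ) ≤ ((n:ℝ) + 1) ^ 3 := one_le_pow₀ (by linarith)
  have hQ6 : 6 ≤ Q := by rw [hQ]; linarith
  have hl2 : 0 < Real.log 2 := Real.log_pos (by norm_num)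
  have hlQ : 0 ≤ Real.log Q := Real.log_nonneg (by linarith)
  set L : ℝ := 2 * (Real.log Q / Real.log 2 + 1) / Real.log 2 + 2 / Real.log 2 with hL
  have hL0 : 0 < L := by positivity
  set D : ℝ := 2 * 1 / (1 / C) + 2 with hD
  have hD0 : 0 < D := by positivity
  refine ⟨L ^ n * D ^ (n * n) * (16 * (n + 1) ^ 3) ^ n * K * Q ^ n, by positivity, ?_⟩
  intro τ hτ hs B hB σ hσ P hP
  have hB0 : 0 < B := by linarith
  have hlB : Real.log 2 ≤ Real.log B := Real.log_le_log (by norm_num) hB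
  have hlB0 : 0 < Real.log B := by linarith
  have hHs : ∀ x : Fin n → ℤ, (∑ k, (x k : ℝ) • τ k).IsSymm := by
    intro x
    rw [Matrix.IsSymm, Matrix.transpose_sum]
    exact Finset.sum_congr rfl fun k _ => by rw [Matrix.transpose_smul, (hs k).eq]
  choose v lam hv hlam hanti using fun x : Fin n → ℤ => eigR _ (hHs x)
  set F0 : ℝ := Q * B with hF0
  have hF01 : 1 ≤ F0 := by rw [hF0]; nlinarith
  have hlamB : ∀ p ∈ P, ∀ i, |lam p.1 i| ≤ F0 := by
    intro p hp i
    have h1 := triR_bound hτ (z := fun k => (p.1 k : ℝ)) (y := v p.1 i) (y' := v p.1 i) hB0.le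
      zero_le_one (hP p hp).1 (on_le_one (hv p.1) i) (on_le_one (hv p.1) i)
    rw [triR_eig _ _ _ _ (hlam p.1 i), hv, if_pos rfl, mul_one] at h1
    refine h1.trans ?_
    have : (n:ℝ) ^ 3 ≤ (n + 1) ^ 3 := pow_le_pow_left₀ hn0 (by linarith) 3
    rw [hF0, hQ]
    nlinarith
  have hmF : ∀ p ∈ P, ∀ i, max 1 |lam p.1 i| ≤ F0 := fun p hp i => max_le hF01 (hlamB p hp i)
  obtain ⟨P1, hP1, hd1, hc1⟩ := pigR P (fun i p => Real.log (max 1 |lam p.1 i|))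
    (fun _ => Real.log F0) (fun _ => Real.log 2) (fun _ => hl2) (by
      intro p hp i
      rw [abs_of_nonneg (Real.log_nonneg (le_max_left _ _))]
      exact Real.log_le_log (by positivity) (hmF p hp i))
  obtain ⟨P2, hP2, hd2, hc2⟩ := pigR P1 (fun (a : Fin n × Fin n) p => v p.1 a.1 a.2)
    (fun _ => 1) (fun _ => 1 / C) (fun _ => by positivity) (fun p _ a => on_le_one (hv p.1) a.1 a.2)
  rw [Finset.prod_const, Finset.card_univ, Fintype.card_fin] at hc1
  rw [Finset.prod_const, Finset.card_univ, Fintype.card_prod, Fintype.card_fin, ← hD] at hc2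
  have hLB : 2 * Real.log F0 / Real.log 2 + 2 ≤ L * Real.log B := by
    have e : Real.log F0 = Real.log Q + Real.log B := Real.log_mul (by linarith) (by linarith)
    have h1 : Real.log Q ≤ Real.log Q / Real.log 2 * Real.log B := by
      rw [div_mul_eq_mul_div, le_div_iff₀ hl2]; gcongr
    have h2 : Real.log F0 ≤ (Real.log Q / Real.log 2 + 1) * Real.log B := by rw [e]; linarith
    have h3 : 2 ≤ 2 / Real.log 2 * Real.log B := by
      rw [div_mul_eq_mul_div, le_div_iff₀ hl2]; gcongr
    have h4 : 2 * Real.log F0 / Real.log 2 ≤ 2 * ((Real.log Q / Real.log 2 + 1) * Real.log B) / Real.log 2 := by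
      gcongr
    calc _ ≤ 2 * ((Real.log Q / Real.log 2 + 1) * Real.log B) / Real.log 2 + 2 / Real.log 2 * Real.log B :=
          add_le_add h4 h3
      _ = _ := by rw [hL]; ring
  have hPc : (P.card : ℝ) ≤ (L * Real.log B) ^ n * (D ^ (n * n) * P2.card) := by
    refine hc1.trans ?_
    have : 0 ≤ Real.log F0 := Real.log_nonneg hF01
    gcongr
  rcases P2.eq_empty_or_nonempty with h | ⟨p0, hp0⟩
  · left
    rw [h] at hPc
    simp only [Finset.card_empty, Nat.cast_zero, mul_zero] at hPc
    refine hPc.trans ?_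
    positivity
  have hsub : ∀ p ∈ P2, p ∈ P := fun p hp => hP1 (hP2 hp)
  set E : Fin n → ℝ := fun i => max 1 |lam p0.1 i| with hE
  have hE1 : ∀ i, 1 ≤ E i := fun i => le_max_left _ _
  have hEF : ∀ i, E i ≤ F0 := fun i => hmF p0 (hsub _ hp0) i
  have hcmp1 : ∀ p ∈ P2, ∀ i, max 1 |lam p.1 i| ≤ 2 * E i := fun p hp i =>
    logcmp (le_max_left _ _) (le_max_left _ _) (hd1 p (hP2 hp) p0 (hP2 hp0) i)
  have hcmp2 : ∀ p ∈ P2, ∀ i, E i ≤ 2 * max 1 |lam p.1 i| := fun p hp i =>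
    logcmp (le_max_left _ _) (le_max_left _ _) (hd1 p0 (hP2 hp0) p (hP2 hp) i)
  set S := P2.image Prod.fst with hS
  have hSmem : ∀ x ∈ S, ∃ p ∈ P2, p.1 = x := fun x hx => Finset.mem_image.1 hx
  rcases hcore τ hτ hs S v lam hv hlam (v p0.1) (hv p0.1) (by
      intro x hx i k
      obtain ⟨p, hp, rfl⟩ := hSmem x hx
      exact hd2 p0 hp0 p hp (i, k)) E F0
      (fun i j hij => max_le_max le_rfl (hanti p0.1 i j hij)) hE1 hEF hF01 (by
      intro x hx i
      obtain ⟨p, hp, rfl⟩ := hSmem x hx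
      exact (le_max_right _ _).trans (hcmp1 p hp i)) (by
      intro x hx x' hx' k
      obtain ⟨p, hp, rfl⟩ := hSmem x hx
      obtain ⟨p', hp', rfl⟩ := hSmem x' hx'
      have h1 := abs_le.1 ((hP p (hsub p hp)).1 k)
      have h2 := abs_le.1 ((hP p' (hsub p' hp')).1 k)
      have : 2 * B ≤ F0 := by rw [hF0]; nlinarith
      rw [abs_le]
      constructor <;> linarith [h1.1, h1.2, h2.1, h2.2]) σ hσ with h | h
  · exact Or.inr h
  left
  have hEpos : ∀ i, 0 < E i := fun i => by linarith [hE1 i]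
  have hfib : (P2.card : ℝ) ≤ S.card * ∏ i, (16 * (n + 1) ^ 3 * B / E i) := by
    rw [Finset.card_eq_sum_card_image Prod.fst P2]
    push_cast
    rw [← nsmul_eq_mul]
    apply Finset.sum_le_card_nsmul
    intro x hx
    obtain ⟨p, hp, rfl⟩ := hSmem x hx
    have hinj : ((P2.filter fun q => q.1 = p.1).image Prod.snd).card = (P2.filter fun q => q.1 = p.1).card := by
      apply Finset.card_image_of_injOn
      intro a ha b hb hab
      simp only [Finset.coe_filter, Set.mem_ofPred_eq] at ha hb
      exact Prod.ext (ha.2.trans hb.2.symm) hab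
    rw [← hinj]
    apply fibR (hHs p.1) (hv p.1) (hlam p.1) B hB0 E hE1 hEF (hcmp2 p hp)
    · intro y hy i
      obtain ⟨q, hq, rfl⟩ := Finset.mem_image.1 hy
      exact (hP q (hsub q (Finset.mem_filter.1 hq).1)).2.1 i
    · intro y hy i
      obtain ⟨q, hq, rfl⟩ := Finset.mem_image.1 hy
      have hq2 := Finset.mem_filter.1 hq
      rw [← hq2.2]
      exact (hP q (hsub q hq2.1)).2.2 i
  have hpd : ∏ i, (16 * (n + 1) ^ 3 * B / E i) = (16 * (n + 1) ^ 3) ^ n * B ^ n / ∏ i, E i := by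
    rw [Finset.prod_div_distrib, Finset.prod_const, Finset.card_univ, Fintype.card_fin, mul_pow]
  have hEp : 0 < ∏ i, E i := Finset.prod_pos fun i _ => hEpos i
  rw [hpd] at hfib
  have hP2c : (P2.card : ℝ) ≤ (16 * (n + 1) ^ 3) ^ n * K * Q ^ n * B ^ (n + σ) := by
    calc (P2.card : ℝ) ≤ _ := hfib
      _ ≤ (K * F0 ^ σ * ∏ i, E i) * ((16 * (n + 1) ^ 3) ^ n * B ^ n / ∏ i, E i) := by gcongr
      _ = (16 * (n + 1) ^ 3) ^ n * K * Q ^ σ * B ^ (n + σ) := by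
          rw [hF0, mul_pow, pow_add]; field_simp
      _ ≤ _ := by
          have : Q ^ σ ≤ Q ^ n := pow_le_pow_right₀ (by linarith) hσ
          gcongr
  calc (P.card : ℝ) ≤ _ := hPc
    _ ≤ (L * Real.log B) ^ n * (D ^ (n * n) * ((16 * (n + 1) ^ 3) ^ n * K * Q ^ n * B ^ (n + σ))) := by gcongr
    _ = _ := by rw [mul_pow]; ring

lemma pderiv_swapR {n : ℕ} (i j : Fin n) (c : MvPolynomial (Fin n) ℝ) :
    pderiv i (pderiv j c) = pderiv j (pderiv i c) := by
  have h : ⁅(pderiv i : Derivation ℝ (MvPolynomial (Fin n) ℝ) (MvPolynomial (Fin n) ℝ)),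
      (pderiv j : Derivation ℝ (MvPolynomial (Fin n) ℝ) (MvPolynomial (Fin n) ℝ))⁆ = 0 := by
    apply MvPolynomial.derivation_ext
    intro k
    rw [Derivation.commutator_apply]
    simp only [pderiv_X, Derivation.zero_apply]
    by_cases h1 : i = k <;> by_cases h2 : j = k <;> simp [h1, h2, eq_comm]
  have h2 := congrArg (fun D => D c) h
  simp only [Derivation.commutator_apply, Derivation.zero_apply] at h2
  exact sub_eq_zero.1 h2

/-- The tensor of third derivatives. -/
noncomputable def tauR {n : ℕ} (c : MvPolynomial (Fin n) ℝ) (k : Fin n) : Matrix (Fin n) (Fin n) ℝ :=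
  Matrix.of fun i j => (cubicNorm c)⁻¹ * MvPolynomial.eval (0 : Fin n → ℝ) (pderiv k (pderiv i (pderiv j c)))

lemma tauR_symm {n : ℕ} (c : MvPolynomial (Fin n) ℝ) (k : Fin n) : (tauR c k).IsSymm := by
  ext i j
  simp only [tauR, Matrix.transpose_apply, Matrix.of_apply]
  rw [pderiv_swapR i j]

lemma tauR_bound {n : ℕ} (c : MvPolynomial (Fin n) ℝ) (k i j : Fin n) : |tauR c k i j| ≤ 6 := by
  simp only [tauR, Matrix.of_apply]
  set f : Fin n → Fin n → Fin n → ℝ := fun i j k =>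
    |MvPolynomial.eval (0 : Fin n → ℝ) (pderiv i (pderiv j (pderiv k c)))| with hf
  have h1 : f k i j ≤ ⨆ j', f k i j' := le_ciSup (Set.finite_range _).bddAbove j
  have h2 : (⨆ j', f k i j') ≤ ⨆ i', ⨆ j', f k i' j' :=
    le_ciSup (f := fun i' => ⨆ j', f k i' j') (Set.finite_range _).bddAbove i
  have h3 : (⨆ i', ⨆ j', f k i' j') ≤ ⨆ k', ⨆ i', ⨆ j', f k' i' j' :=
    le_ciSup (f := fun k' => ⨆ i', ⨆ j', f k' i' j') (Set.finite_range _).bddAbove k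
  have h4 : f k i j ≤ 6 * cubicNorm c := by
    have e : cubicNorm c = (1 / 6) * ⨆ k', ⨆ i', ⨆ j', f k' i' j' := rfl
    rw [e]; linarith
  have h0 : 0 ≤ f k i j := abs_nonneg _
  have hc0 : 0 ≤ cubicNorm c := by linarith
  rw [abs_mul, abs_of_nonneg (inv_nonneg.2 hc0)]
  change (cubicNorm c)⁻¹ * f k i j ≤ 6
  rcases hc0.eq_or_lt with h | h
  · rw [← h]; simp
  · rw [inv_mul_le_iff₀ h]; linarith

lemma hessR {n : ℕ} (c : MvPolynomial (Fin n) ℝ) (hc : c.IsHomogeneous 3) (x : Fin n → ℝ) :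
    hessMat c x = ∑ k, x k • tauR c k := by
  ext i j
  rw [Matrix.sum_apply]
  simp only [hessMat, tauR, Matrix.smul_apply, Matrix.of_apply, smul_eq_mul]
  have h1 : (pderiv i (pderiv j c)).IsHomogeneous 1 := (hc.pderiv (i := j)).pderiv (i := i)
  have h2 := congrArg (MvPolynomial.eval x) h1.sum_X_mul_pderiv
  rw [one_smul, map_sum] at h2
  rw [← h2, Finset.mul_sum]
  refine Finset.sum_congr rfl fun k _ => ?_
  have h3 : (pderiv k (pderiv i (pderiv j c))).IsHomogeneous 0 := h1.pderiv (i := k)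
  rw [← totalDegree_zero_iff_isHomogeneous, totalDegree_eq_zero_iff_eq_C] at h3
  rw [map_mul, eval_X, h3, eval_C, eval_C]
  ring

/-- Either `N^aux_c(B) ≤ A₁·B^{n+σ}·(log B)^n`, or there are
positive-dimensional subspaces `X, Y` with `dim X + dim Y = n + σ + 1` on which
the trilinear form `Yᵀ H_c(X) Y'` is small. -/
theorem statement9 (n : ℕ) :
    ∃ A₂ : ℝ, 0 < A₂ ∧
      ∀ C : ℝ, 1 ≤ C →
      ∃ A₁ : ℝ, 0 < A₁ ∧
        ∀ (c : MvPolynomial (Fin n) ℝ), c ≠ 0 → c.IsHomogeneous 3 →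
        ∀ B : ℝ, 2 ≤ B → ∀ σ : ℕ, σ ≤ n - 1 →
          ((Naux c B : ℝ) ≤ A₁ * B ^ (n + σ) * Real.log B ^ n) ∨
          (∃ X Y : Submodule ℝ (Fin n → ℝ),
            0 < Module.finrank ℝ X ∧ 0 < Module.finrank ℝ Y ∧
            Module.finrank ℝ X + Module.finrank ℝ Y = n + σ + 1 ∧
            ∀ x ∈ X, ∀ y ∈ Y, ∀ y' ∈ Y,
              |y ⬝ᵥ (hessMat c x).mulVec y'| ≤
                A₂ * C⁻¹ * ‖y‖ * ‖x‖ * ‖y'‖) := by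
  refine ⟨24 * (n + 1) ^ 12, by positivity, ?_⟩
  intro C hC
  obtain ⟨A, hA, h⟩ := absR n C hC
  refine ⟨A, hA, ?_⟩
  intro c _ hc B hB σ hσ
  have hfin : {p : (Fin n → ℤ) × (Fin n → ℤ) |
      (∀ i, (|p.1 i| : ℝ) ≤ B) ∧ (∀ i, (|p.2 i| : ℝ) ≤ B) ∧
      (∀ i, |(hessMat c (fun j => (p.1 j : ℝ))).mulVec (fun j => (p.2 j : ℝ)) i| < B)}.Finite := by
    have hbox : ∀ x : Fin n → ℤ, (∀ i, (|x i| : ℝ) ≤ B) →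
        x ∈ Set.Icc (fun _ : Fin n => -⌈B⌉) (fun _ => ⌈B⌉) := by
      intro x hx
      have hx' : ∀ i, |x i| ≤ ⌈B⌉ := by
        intro i
        have : ((|x i| : ℤ) : ℝ) ≤ ⌈B⌉ := by
          push_cast; exact (hx i).trans (Int.le_ceil B)
        exact_mod_cast this
      exact ⟨fun i => (abs_le.1 (hx' i)).1, fun i => (abs_le.1 (hx' i)).2⟩
    refine ((Set.finite_Icc (fun _ : Fin n => -⌈B⌉) (fun _ => ⌈B⌉)).prod
      (Set.finite_Icc (fun _ : Fin n => -⌈B⌉) (fun _ => ⌈B⌉))).subset ?_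
    rintro p ⟨h1, h2, _⟩
    exact ⟨hbox _ h1, hbox _ h2⟩
  rcases h (tauR c) (tauR_bound c) (tauR_symm c) B hB σ (by omega) hfin.toFinset (by
    intro p hp
    obtain ⟨h1, h2, h3⟩ := hfin.mem_toFinset.1 hp
    refine ⟨h1, h2, fun i => ?_⟩
    rw [← hessR c hc (fun k => (p.1 k : ℝ))]
    exact (h3 i).le) with h | h
  · left
    rw [← Set.ncard_eq_toFinset_card _ hfin] at h
    exact h
  · right
    obtain ⟨X, Y, h1, h2, h3, h4⟩ := h
    refine ⟨X, Y, h1, h2, h3, ?_⟩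
    intro x hx y hy y' hy'
    rw [hessR c hc x, ← triR_eq]
    exact h4 x hx y hy y' hy'
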